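/- arXiv:2104.04853 — 3 statements merged into one kernel-verified Lean document; each statement's English description precedes it below -/
import Mathlib

section
/- Let E be a finite type with decidable equality and let g : Finset E -> Real be nonnegative (g(S) >= 0 for all S) and submodular, i.e. g(S union T) + g(S inter T) <= g(S) + g(T) for all finsets S, T. Then for all finsets A, B, C with B inter C a subset of A, one has g(A union B) + g(A union C) >= g(A). -/
theorem submodular_nonneg_triple_bound {E : Type*} [Fintype E] [DecidableEq E]
    (g : Finset E → ℝ)
    (hnonneg : ∀ S : Finset E, 0 ≤ g S)
    (hsub : ∀ S T : Finset E, g (S ∪ T) + g (S ∩ T) ≤ g S + g T) :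
    ∀ A B C : Finset E, B ∩ C ⊆ A →
      g (A ∪ B) + g (A ∪ C) ≥ g A := by
  intro A B C hBC
  have hinter : (A ∪ B) ∩ (A ∪ C) = A := by
    rw [← Finset.union_inter_distrib_left, Finset.union_eq_left.mpr hBC]
  have hAB := hsub (A ∪ B) (A ∪ C)
  rw [hinter] at hAB
  linarith [hnonneg (A ∪ B ∪ (A ∪ C))]
end

section
/- In the finite adaptive-optimization model described in the context, suppose f is adaptive submodular with respect to p, and let pi_a, pi_b, pi_c be deterministic policies with range(pi_b) inter range(pi_c) = empty. Then f_avg(pi_a @ pi_c) - f_avg(pi_a) >= f_avg(pi_a @ pi_b @ pi_c) - f_avg(pi_a @ pi_b); explicitly, sum over phi of p(phi)*( f(E(pi_a,phi) union E(pi_c,phi), phi) - f(E(pi_a,phi), phi) ) >= sum over phi of p(phi)*( f(E(pi_a,phi) union E(pi_b,phi) union E(pi_c,phi), phi) - f(E(pi_a,phi) union E(pi_b,phi), phi) ). -/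
open Finset

variable {E O : Type*}

/-- The probability of the partial realization `(S, ψ)`: the total prior mass of
realizations agreeing with `ψ` on `S`. -/
def prPartial [Fintype E] [DecidableEq E] [Fintype O] [DecidableEq O]
    (p : (E → O) → ℝ) (S : Finset E) (ψ : E → O) : ℝ :=
  ∑ φ ∈ Finset.univ.filter (fun φ : E → O => ∀ e ∈ S, φ e = ψ e), p φ

/-- The conditional expected marginal utility `Δ(e | S, ψ)` of item `e` given
the partial realization `(S, ψ)`. -/
noncomputable def condMarginal [Fintype E] [DecidableEq E] [Fintype O] [DecidableEq O]
    (p : (E → O) → ℝ) (f : Finset E → (E → O) → ℝ)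
    (e : E) (S : Finset E) (ψ : E → O) : ℝ :=
  (∑ φ ∈ Finset.univ.filter (fun φ : E → O => ∀ a ∈ S, φ a = ψ a),
      p φ * (f (insert e S) φ - f S φ)) / prPartial p S ψ

/-- `f` is adaptive submodular with respect to the prior `p`. -/
def AdaptiveSubmodular [Fintype E] [DecidableEq E] [Fintype O] [DecidableEq O]
    (p : (E → O) → ℝ) (f : Finset E → (E → O) → ℝ) : Prop :=
  ∀ (S S' : Finset E) (ψ ψ' : E → O), S ⊆ S' → (∀ e ∈ S, ψ' e = ψ e) →
    0 < prPartial p S' ψ' → ∀ e ∉ S',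
      condMarginal p f e S ψ ≥ condMarginal p f e S' ψ'

/-- A deterministic adaptive policy: given the set of already-selected items and a
realization (only the states of the selected items may be consulted), it either
selects a fresh item or stops. -/
structure Policy (E O : Type*) [DecidableEq E] where
  act : Finset E → (E → O) → Option E
  act_congr : ∀ (S : Finset E) (ψ ψ' : E → O), (∀ e ∈ S, ψ e = ψ' e) → act S ψ = act S ψ'
  act_fresh : ∀ (S : Finset E) (ψ : E → O) (e : E), act S ψ = some e → e ∉ S

/-- Run the policy for at most `n` more steps starting from the current set `S`. -/
def selectAux [DecidableEq E] (π : Policy E O) (φ : E → O) : ℕ → Finset E → Finset E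
  | 0, S => S
  | n + 1, S =>
    match π.act S φ with
    | none => S
    | some e => selectAux π φ n (insert e S)

/-- The set of items selected by policy `π` under realization `φ`. -/
def selected [Fintype E] [DecidableEq E] (π : Policy E O) (φ : E → O) : Finset E :=
  selectAux π φ (Fintype.card E) ∅

/-- The range of a policy: all items it selects under some realization of positive
prior probability. -/
def polRange [Fintype E] [DecidableEq E] (p : (E → O) → ℝ) (π : Policy E O) : Set E :=
  { e | ∃ φ : E → O, 0 < p φ ∧ e ∈ selected π φ }

/-- A realization-dependent set of items is observable if it is determined by the states of the
items it contains. -/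
def ObservableSet (T : (E → O) → Finset E) : Prop :=
  ∀ φ φ' : E → O, (∀ e ∈ T φ, φ' e = φ e) → T φ' = T φ

theorem ObservableSet.union [DecidableEq E] {T U : (E → O) → Finset E}
    (hT : ObservableSet T) (hU : ObservableSet U) : ObservableSet (fun φ => T φ ∪ U φ) := by
  intro φ φ' h
  have h₁ := hT φ φ' fun e he => h e (mem_union_left _ he)
  have h₂ := hU φ φ' fun e he => h e (mem_union_right _ he)
  simp only [h₁, h₂]

theorem selectAux_succ [DecidableEq E] (π : Policy E O) (φ : E → O) (n : ℕ) (S : Finset E) :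
    selectAux π φ (n + 1) S =
      selectAux π φ n S ∪ (π.act (selectAux π φ n S) φ).toFinset := by
  induction n generalizing S with
  | zero =>
    cases h : π.act S φ <;> simp [selectAux, h]
  | succ n ih =>
    cases h : π.act S φ with
    | none => simp [selectAux, h]
    | some e =>
      have h₁ : ∀ m, selectAux π φ (m + 1) S = selectAux π φ m (insert e S) := by
        intro m
        simp [selectAux, h]
      rw [h₁ (n + 1), h₁ n, ih]

theorem selectAux_mono [DecidableEq E] (π : Policy E O) (φ : E → O) (S : Finset E) :
    Monotone fun n => selectAux π φ n S :=
  monotone_nat_of_le_succ fun n => by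
    rw [selectAux_succ]
    exact subset_union_left

theorem observableSet_selectAux [DecidableEq E] (π : Policy E O) (n : ℕ) (S : Finset E) :
    ObservableSet fun φ => selectAux π φ n S := by
  induction n with
  | zero => intro φ φ' _; rfl
  | succ n ih =>
    intro φ φ' h
    have h₀ : ∀ e ∈ selectAux π φ n S, φ' e = φ e :=
      fun e he => h e (selectAux_mono π φ S n.le_succ he)
    have h₁ : selectAux π φ' n S = selectAux π φ n S := ih φ φ' h₀
    simp only [selectAux_succ, h₁, π.act_congr _ φ' φ h₀]

/-- The tower property: averaging `G` equals averaging its conditional expectation given the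
states of the items of an observable set. -/
theorem ObservableSet.sum_condExp_eq [Fintype E] [DecidableEq E] [Fintype O] [DecidableEq O]
    {p : (E → O) → ℝ} (hp : ∀ φ, 0 ≤ p φ) {T : (E → O) → Finset E} (hT : ObservableSet T)
    (G : (E → O) → ℝ) :
    ∑ φ, p φ * ((∑ φ' ∈ univ.filter (fun φ' : E → O => ∀ a ∈ T φ, φ' a = φ a), p φ' * G φ') /
      prPartial p (T φ) φ) = ∑ φ, p φ * G φ := by
  have hsymm : ∀ φ φ' : E → O, (∀ a ∈ T φ, φ' a = φ a) → ∀ a ∈ T φ', φ a = φ' a := by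
    intro φ φ' h a ha
    rw [hT φ φ' h] at ha
    exact (h a ha).symm
  have hpr : ∀ φ φ' : E → O, (∀ a ∈ T φ, φ' a = φ a) →
      prPartial p (T φ') φ' = prPartial p (T φ) φ := by
    intro φ φ' h
    unfold prPartial
    rw [hT φ φ' h]
    refine sum_congr (filter_congr fun χ _ => ?_) fun _ _ => rfl
    exact forall₂_congr fun a ha => by rw [h a ha]
  calc
    _ = ∑ φ, ∑ φ', if ∀ a ∈ T φ, φ' a = φ a then
          p φ * (p φ' * G φ' / prPartial p (T φ) φ) else 0 := by
      refine sum_congr rfl fun φ _ => ?_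
      rw [sum_div, mul_sum, sum_filter]
    _ = ∑ φ', ∑ φ, if ∀ a ∈ T φ', φ a = φ' a then
          p φ * (p φ' * G φ' / prPartial p (T φ') φ') else 0 := by
      rw [sum_comm]
      refine sum_congr rfl fun φ' _ => sum_congr rfl fun φ _ => ?_
      by_cases h : ∀ a ∈ T φ, φ' a = φ a
      · rw [if_pos h, if_pos (hsymm φ φ' h), hpr φ φ' h]
      · rw [if_neg h, if_neg fun h' => h (hsymm φ' φ h')]
    _ = ∑ φ', p φ' * G φ' := by
      refine sum_congr rfl fun φ' _ => ?_
      rw [← sum_filter, ← sum_mul]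
      change prPartial p (T φ') φ' * _ = _
      by_cases h : prPartial p (T φ') φ' = 0
      · have h₀ : p φ' = 0 :=
          (sum_eq_zero_iff_of_nonneg fun χ _ => hp χ).1 h φ' (by simp)
        simp [h₀]
      · field_simp

theorem sum_marginal_eq_sum_condMarginal [Fintype E] [DecidableEq E] [Fintype O] [DecidableEq O]
    {p : (E → O) → ℝ} (hp : ∀ φ, 0 ≤ p φ) (f : Finset E → (E → O) → ℝ)
    {T : (E → O) → Finset E} (hT : ObservableSet T) {i : (E → O) → Option E}
    (hi : ∀ φ φ' : E → O, (∀ a ∈ T φ, φ' a = φ a) → i φ' = i φ) :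
    ∑ φ, p φ * (f (T φ ∪ (i φ).toFinset) φ - f (T φ) φ) =
      ∑ φ, p φ * (i φ).elim 0 (fun e => condMarginal p f e (T φ) φ) := by
  rw [← hT.sum_condExp_eq hp]
  refine sum_congr rfl fun φ _ => ?_
  congr 1
  have h : ∀ φ' ∈ univ.filter (fun φ' : E → O => ∀ a ∈ T φ, φ' a = φ a),
      p φ' * (f (T φ' ∪ (i φ').toFinset) φ' - f (T φ') φ') =
        p φ' * (f (T φ ∪ (i φ).toFinset) φ' - f (T φ) φ') := by
    intro φ' h
    have h' := (mem_filter.1 h).2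
    rw [hT φ φ' h', hi φ φ' h']
  rw [sum_congr rfl h]
  cases hφ : i φ with
  | none => simp
  | some e => simp [condMarginal]

theorem AdaptiveSubmodular.sum_marginal_le [Fintype E] [DecidableEq E] [Fintype O] [DecidableEq O]
    {p : (E → O) → ℝ} {f : Finset E → (E → O) → ℝ} (hAS : AdaptiveSubmodular p f)
    (hp : ∀ φ, 0 ≤ p φ) {T U : (E → O) → Finset E} (hT : ObservableSet T) (hU : ObservableSet U)
    (hTU : ∀ φ, T φ ⊆ U φ) {i : (E → O) → Option E}
    (hi : ∀ φ φ' : E → O, (∀ a ∈ T φ, φ' a = φ a) → i φ' = i φ)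
    (hmem : ∀ φ e, 0 < p φ → i φ = some e → e ∈ U φ → e ∈ T φ) :
    ∑ φ, p φ * (f (U φ ∪ (i φ).toFinset) φ - f (U φ) φ) ≤
      ∑ φ, p φ * (f (T φ ∪ (i φ).toFinset) φ - f (T φ) φ) := by
  rw [sum_marginal_eq_sum_condMarginal hp f hT hi,
    sum_marginal_eq_sum_condMarginal hp f hU
      fun φ φ' h => hi φ φ' fun a ha => h a (hTU φ ha)]
  refine sum_le_sum fun φ _ => ?_
  rcases (hp φ).eq_or_lt with h₀ | hpos
  · simp [← h₀]
  refine mul_le_mul_of_nonneg_left ?_ hpos.le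
  cases hφ : i φ with
  | none => simp
  | some e =>
    simp only [Option.elim_some]
    by_cases he : e ∈ U φ
    · have he' := hmem φ e hpos hφ he
      simp [condMarginal, insert_eq_of_mem he, insert_eq_of_mem he']
    · refine hAS (T φ) (U φ) φ φ (hTU φ) (fun _ _ => rfl) ?_ e he
      exact sum_pos' (fun χ _ => hp χ) ⟨φ, by simp, hpos⟩

theorem adaptive_submodular_concat_marginal
    [Fintype E] [DecidableEq E] [Fintype O] [DecidableEq O]
    (p : (E → O) → ℝ) (f : Finset E → (E → O) → ℝ)
    (hp : ∀ φ, 0 ≤ p φ) (hp1 : ∑ φ : E → O, p φ = 1)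
    (hf : ∀ (S : Finset E) (φ : E → O), 0 ≤ f S φ)
    (hAS : AdaptiveSubmodular p f)
    (πa πb πc : Policy E O)
    (hdisj : polRange p πb ∩ polRange p πc = ∅) :
    ∑ φ : E → O, p φ * (f (selected πa φ ∪ selected πc φ) φ - f (selected πa φ) φ) ≥
      ∑ φ : E → O,
        p φ * (f (selected πa φ ∪ selected πb φ ∪ selected πc φ) φ
          - f (selected πa φ ∪ selected πb φ) φ) := by
  suffices h : ∀ n ≤ Fintype.card E,
      ∑ φ, p φ * (f (selected πa φ ∪ selected πb φ ∪ selectAux πc φ n ∅) φ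
          - f (selected πa φ ∪ selected πb φ) φ) ≤
        ∑ φ, p φ * (f (selected πa φ ∪ selectAux πc φ n ∅) φ - f (selected πa φ) φ) from
    h _ le_rfl
  have hobs : ∀ (π : Policy E O), ObservableSet (selected π) :=
    fun π => observableSet_selectAux π _ ∅
  intro n
  induction n with
  | zero => intro _; simp [selectAux]
  | succ n ih =>
    intro hn
    have hstep := hAS.sum_marginal_le hp
      (T := fun φ => selected πa φ ∪ selectAux πc φ n ∅)
      (U := fun φ => selected πa φ ∪ selected πb φ ∪ selectAux πc φ n ∅)
      (i := fun φ => πc.act (selectAux πc φ n ∅) φ)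
      ((hobs πa).union (observableSet_selectAux πc n ∅))
      (((hobs πa).union (hobs πb)).union (observableSet_selectAux πc n ∅))
      (fun φ => union_subset_union_left subset_union_left)
      (fun φ φ' h => by
        have h' : ∀ a ∈ selectAux πc φ n ∅, φ' a = φ a := fun a ha => h a (mem_union_right _ ha)
        have h₁ : selectAux πc φ' n ∅ = selectAux πc φ n ∅ :=
          observableSet_selectAux πc n ∅ φ φ' h'
        simp only [h₁]
        exact πc.act_congr _ _ _ h')
      (fun φ e hpos he hmem => by
        have hc : e ∈ selected πc φ := by
          refine selectAux_mono πc φ ∅ hn ?_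
          simp only [selectAux_succ, he]
          simp
        have hb : e ∉ selected πb φ := fun hb => by
          have : e ∈ polRange p πb ∩ polRange p πc := ⟨⟨φ, hpos, hb⟩, ⟨φ, hpos, hc⟩⟩
          simp [hdisj] at this
        simp only [mem_union] at hmem ⊢
        tauto)
    have hsum := add_le_add (ih (n.le_succ.trans hn)) hstep
    simp only [← sum_add_distrib, ← mul_add, union_assoc, ← selectAux_succ] at hsum ⊢
    simpa only [sub_add_sub_cancel'] using hsum
end

section
/- (Deterministic specialization of the paper's Lemma 2.) In the deterministic knapsack setting of the context, let sigma be a real number with 0 < sigma <= 1 and let the random set S include each item of E independently with probability sigma, so that for any function h : Finset E -> Real, Exp_S[h(S)] = sum over subsets S of E of sigma^|S| * (1-sigma)^(|E|-|S|) * h(S). Let T* be a feasible set achieving the maximum of g(T) over all finsets T with c(T) <= b. Then (2 + 1/sigma) * Exp_S[ g(DG(S)) ] + max over e in E of g({e}) >= Exp_S[ g(T* union DG(S)) ]. -/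
open Finset

variable {E : Type*}

/-- Pick, from a nonempty finset `F`, the element maximizing the score `r`,
breaking ties by taking the least such element in the fixed linear order. -/
noncomputable def pick [LinearOrder E] (F : Finset E) (r : E → ℝ) (h : F.Nonempty) : E :=
  (F.filter fun e => ∀ e' ∈ F, r e' ≤ r e).min' (by
    obtain ⟨a, ha, hm⟩ := F.exists_max_image r h
    exact ⟨a, Finset.mem_filter.mpr ⟨ha, hm⟩⟩)

/-- One pass of density greedy with fuel `n`: `V` is the set selected so far and
`C` the remaining budget. -/
noncomputable def densityGreedyAux [DecidableEq E] [LinearOrder E]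
    (g : Finset E → ℝ) (c : E → ℝ) (S : Finset E) :
    ℕ → Finset E → ℝ → Finset E
  | 0, V, _ => V
  | n + 1, V, C =>
    let F := S.filter fun e => e ∉ V ∧ c e ≤ C ∧ 0 < g (insert e V) - g V
    if h : F.Nonempty then
      let e := pick F (fun e => (g (insert e V) - g V) / c e) h
      densityGreedyAux g c S n (insert e V) (C - c e)
    else V

/-- The output of density greedy run on the available item set `S` with budget `b`. -/
noncomputable def densityGreedy [Fintype E] [DecidableEq E] [LinearOrder E]
    (g : Finset E → ℝ) (c : E → ℝ) (b : ℝ) (S : Finset E) : Finset E :=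
  densityGreedyAux g c S (Fintype.card E) ∅ b

lemma pick_mem [LinearOrder E] (F : Finset E) (r : E → ℝ) (h : F.Nonempty) :
    pick F r h ∈ F :=
  (Finset.mem_filter.mp (Finset.min'_mem (F.filter fun e => ∀ e' ∈ F, r e' ≤ r e) _)).1

lemma le_pick [LinearOrder E] (F : Finset E) (r : E → ℝ) (h : F.Nonempty) {e : E}
    (he : e ∈ F) : r e ≤ r (pick F r h) :=
  (Finset.mem_filter.mp (Finset.min'_mem (F.filter fun e => ∀ e' ∈ F, r e' ≤ r e) _)).2 e he

lemma pick_le_of_forall_le [LinearOrder E] (F : Finset E) (r : E → ℝ) (h : F.Nonempty) {e : E}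
    (he : e ∈ F) (hr : ∀ e' ∈ F, r e' ≤ r e) : pick F r h ≤ e :=
  Finset.min'_le _ _ (Finset.mem_filter.mpr ⟨he, hr⟩)

lemma pick_eq_of_subset [LinearOrder E] {F F' : Finset E} (r : E → ℝ) (h : F.Nonempty)
    (h' : F'.Nonempty) (hF : F ⊆ F') (hp : pick F' r h' ∈ F) : pick F r h = pick F' r h' := by
  apply le_antisymm
  · exact pick_le_of_forall_le F r h hp fun e he => le_pick F' r h' (hF he)
  · exact pick_le_of_forall_le F' r h' (hF (pick_mem F r h)) fun e he =>
      (le_pick F' r h' he).trans (le_pick F r h hp)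

lemma marginal_antitone [DecidableEq E] {g : Finset E → ℝ}
    (hsub : ∀ S T : Finset E, g (S ∪ T) + g (S ∩ T) ≤ g S + g T)
    {V W : Finset E} (hVW : V ⊆ W) {e : E} (he : e ∉ W) :
    g (insert e W) - g W ≤ g (insert e V) - g V := by
  have h := hsub (insert e V) W
  rw [Finset.insert_union, Finset.union_eq_right.mpr hVW, Finset.insert_inter_of_notMem he,
    Finset.inter_eq_left.mpr hVW] at h
  linarith

lemma le_add_sum_marginal [DecidableEq E] {g : Finset E → ℝ}
    (hsub : ∀ S T : Finset E, g (S ∪ T) + g (S ∩ T) ≤ g S + g T)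
    (T V : Finset E) : g (T ∪ V) ≤ g V + ∑ e ∈ T \ V, (g (insert e V) - g V) := by
  have key : ∀ A : Finset E, Disjoint A V →
      g (A ∪ V) ≤ g V + ∑ e ∈ A, (g (insert e V) - g V) := by
    intro A
    induction A using Finset.induction_on with
    | empty => simp
    | insert a A ha ih =>
      intro hd
      rw [Finset.disjoint_insert_left] at hd
      have h1 := ih hd.2
      have h2 := marginal_antitone hsub (Finset.subset_union_right (s₁ := A) (s₂ := V))
        (e := a) (by simp [ha, hd.1])
      rw [Finset.sum_insert ha, Finset.insert_union]
      linarith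
  simpa using key (T \ V) Finset.sdiff_disjoint

section Greedy

variable [DecidableEq E] (g : Finset E → ℝ) (c : E → ℝ)

/-- The items of `S` that density greedy may add to `V` with remaining budget `C`. -/
noncomputable def eligible (S V : Finset E) (C : ℝ) : Finset E :=
  S.filter fun e => e ∉ V ∧ c e ≤ C ∧ 0 < g (insert e V) - g V

/-- The marginal gain per unit of cost of an item with respect to `V`. -/
noncomputable def density (V : Finset E) (e : E) : ℝ := (g (insert e V) - g V) / c e

variable {g c}

lemma mem_eligible {S V : Finset E} {C : ℝ} {e : E} :
    e ∈ eligible g c S V C ↔ e ∈ S ∧ e ∉ V ∧ c e ≤ C ∧ 0 < g (insert e V) - g V :=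
  Finset.mem_filter

variable [LinearOrder E]

lemma densityGreedyAux_succ_of_nonempty {S V : Finset E} {n : ℕ} {C : ℝ}
    (h : (eligible g c S V C).Nonempty) :
    densityGreedyAux g c S (n + 1) V C =
      densityGreedyAux g c S n (insert (pick _ (density g c V) h) V)
        (C - c (pick _ (density g c V) h)) :=
  dif_pos h

lemma densityGreedyAux_succ_of_not_nonempty {S V : Finset E} {n : ℕ} {C : ℝ}
    (h : ¬ (eligible g c S V C).Nonempty) : densityGreedyAux g c S (n + 1) V C = V :=
  dif_neg h

variable (g c) in
/-- The marginal gain of `e` at the moment density greedy picks it, and `0` if it is never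
picked. -/
noncomputable def pickGain (S : Finset E) (e : E) : ℕ → Finset E → ℝ → ℝ
  | 0, _, _ => 0
  | n + 1, V, C =>
    if h : (eligible g c S V C).Nonempty then
      if pick _ (density g c V) h = e then g (insert e V) - g V
      else pickGain S e n (insert (pick _ (density g c V) h) V)
        (C - c (pick _ (density g c V) h))
    else 0

lemma pickGain_eq_zero_of_mem {S : Finset E} {e : E} (n : ℕ) {V : Finset E} (C : ℝ)
    (he : e ∈ V) : pickGain g c S e n V C = 0 := by
  induction n generalizing V C with
  | zero => rfl
  | succ n ih =>
    rw [pickGain]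
    split_ifs with h hp
    · simp [Finset.insert_eq_of_mem he]
    · exact ih _ (Finset.mem_insert_of_mem he)
    · rfl

lemma pickGain_nonneg (S : Finset E) (e : E) (n : ℕ) (V : Finset E) (C : ℝ) :
    0 ≤ pickGain g c S e n V C := by
  induction n generalizing V C with
  | zero => exact le_rfl
  | succ n ih =>
    rw [pickGain]
    split_ifs with h hp
    · have := (mem_eligible.mp (pick_mem _ (density g c V) h)).2.2.2
      rw [hp] at this
      exact this.le
    · exact ih _ _
    · exact le_rfl

lemma sum_pickGain (S : Finset E) (n : ℕ) (V : Finset E) (C : ℝ) :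
    ∑ e ∈ S, pickGain g c S e n V C = g (densityGreedyAux g c S n V C) - g V := by
  induction n generalizing V C with
  | zero => simp [pickGain, densityGreedyAux]
  | succ n ih =>
    by_cases h : (eligible g c S V C).Nonempty
    · rw [densityGreedyAux_succ_of_nonempty h]
      simp only [pickGain, dif_pos h]
      have hpS := (mem_eligible.mp (pick_mem _ (density g c V) h)).1
      set p := pick _ (density g c V) h
      have key := ih (insert p V) (C - c p)
      rw [← Finset.add_sum_erase _ _ hpS,
        pickGain_eq_zero_of_mem _ _ (Finset.mem_insert_self p V)] at key
      rw [← Finset.add_sum_erase _ _ hpS, if_pos rfl]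
      rw [Finset.sum_congr rfl fun e he => if_neg (Finset.ne_of_mem_erase he).symm]
      linarith
    · rw [densityGreedyAux_succ_of_not_nonempty h]
      simp [pickGain, h]

lemma subset_densityGreedyAux (S : Finset E) (n : ℕ) (V : Finset E) (C : ℝ) :
    V ⊆ densityGreedyAux g c S n V C := by
  induction n generalizing V C with
  | zero => exact Finset.Subset.refl _
  | succ n ih =>
    by_cases h : (eligible g c S V C).Nonempty
    · rw [densityGreedyAux_succ_of_nonempty h]
      exact (Finset.subset_insert _ _).trans (ih _ _)
    · rw [densityGreedyAux_succ_of_not_nonempty h]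

lemma le_densityGreedyAux (S : Finset E) (n : ℕ) (V : Finset E) (C : ℝ) :
    g V ≤ g (densityGreedyAux g c S n V C) := by
  have := sum_pickGain (g := g) (c := c) S n V C
  have := Finset.sum_nonneg fun e (_ : e ∈ S) => pickGain_nonneg (g := g) (c := c) S e n V C
  linarith

/-- An item whose final marginal gain exceeds its gain when offered to density greedy bounds the
value collected per unit of budget, for as long as the item is affordable. -/
lemma density_mul_le_densityGreedyAux [Fintype E]
    (hsub : ∀ S T : Finset E, g (S ∪ T) + g (S ∩ T) ≤ g S + g T) (hc : ∀ e, 0 < c e)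
    (S : Finset E) {u : E} {k : ℝ} (hk : c u ≤ k) (n : ℕ) (V : Finset E) (C : ℝ)
    (hn : Fintype.card E ≤ V.card + n)
    (hu : u ∉ densityGreedyAux g c S n V C)
    (hgain : pickGain g c (insert u S) u n V C <
      g (insert u (densityGreedyAux g c S n V C)) - g (densityGreedyAux g c S n V C)) :
    density g c (densityGreedyAux g c S n V C) u * (C - k) ≤
      g (densityGreedyAux g c S n V C) - g V := by
  induction n generalizing V C with
  | zero =>
    have : V = Finset.univ :=
      Finset.eq_univ_of_card V (le_antisymm V.card_le_univ (by simpa using hn))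
    simp [densityGreedyAux, this] at hu
  | succ n ih =>
    have hpos := (pickGain_nonneg _ _ _ _ _).trans_lt hgain
    rcases lt_or_ge C k with hCk | hCk
    · have h1 := le_densityGreedyAux (g := g) (c := c) S (n + 1) V C
      have h2 : 0 ≤ density g c (densityGreedyAux g c S (n + 1) V C) u :=
        div_nonneg hpos.le (hc u).le
      nlinarith
    have hsubset := subset_densityGreedyAux (g := g) (c := c) S (n + 1) V C
    have hanti := marginal_antitone hsub hsubset hu
    have hu' : u ∈ eligible g c (insert u S) V C :=
      mem_eligible.mpr ⟨Finset.mem_insert_self _ _, fun h => hu (hsubset h), hk.trans hCk,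
        hpos.trans_le hanti⟩
    have hne' : (eligible g c (insert u S) V C).Nonempty := ⟨u, hu'⟩
    have hp := pick_mem _ (density g c V) hne'
    have hmax := le_pick _ (density g c V) hne' hu'
    by_cases hpu : pick _ (density g c V) hne' = u
    · rw [pickGain, dif_pos hne', if_pos hpu] at hgain
      linarith
    have hpF : pick _ (density g c V) hne' ∈ eligible g c S V C := by
      rw [mem_eligible] at hp ⊢
      exact ⟨(Finset.mem_insert.mp hp.1).resolve_left hpu, hp.2⟩
    have hne : (eligible g c S V C).Nonempty := ⟨_, hpF⟩
    have heq : pick _ (density g c V) hne = pick _ (density g c V) hne' :=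
      pick_eq_of_subset _ hne hne' (Finset.filter_subset_filter _ (Finset.subset_insert _ _)) hpF
    rw [pickGain, dif_pos hne', if_neg hpu] at hgain
    rw [densityGreedyAux_succ_of_nonempty hne, heq] at hgain hu hanti ⊢
    set p := pick _ (density g c V) hne'
    have hpV : p ∉ V := (mem_eligible.mp hp).2.1
    have hstep := ih (insert p V) (C - c p) (by rw [Finset.card_insert_of_notMem hpV]; omega)
      hu hgain
    set W := densityGreedyAux g c S n (insert p V) (C - c p)
    have hd : density g c W u ≤ density g c V p :=
      (div_le_div_of_nonneg_right hanti (hc u).le).trans hmax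
    have hgp : density g c V p * c p = g (insert p V) - g V := div_mul_cancel₀ _ (hc p).ne'
    have := mul_le_mul_of_nonneg_right hd (hc p).le
    linarith

lemma union_densityGreedy_le [Fintype E] [Nonempty E] {b : ℝ} (hg : ∀ S : Finset E, 0 ≤ g S)
    (hsub : ∀ S T : Finset E, g (S ∪ T) + g (S ∩ T) ≤ g S + g T) (hc : ∀ e, 0 < c e)
    {T : Finset E} (hT : ∑ e ∈ T, c e ≤ b) (S : Finset E) :
    g (T ∪ densityGreedy g c b S) ≤ 2 * g (densityGreedy g c b S) +
      ∑ e, pickGain g c (insert e S) e (Fintype.card E) ∅ b +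
      Finset.univ.sup' Finset.univ_nonempty fun e : E => g {e} := by
  set V := densityGreedy g c b S with hV
  set M := Finset.univ.sup' Finset.univ_nonempty fun e : E => g {e}
  set G : E → ℝ := fun e => pickGain g c (insert e S) e (Fintype.card E) ∅ b
  set m : E → ℝ := fun e => g (insert e V) - g V with hm
  have hM : ∀ e, g {e} ≤ M := fun e => Finset.le_sup' (fun e : E => g {e}) (Finset.mem_univ e)
  have hM0 : 0 ≤ M := (hg _).trans (hM (Classical.arbitrary E))
  have hG : ∀ e, 0 ≤ G e := fun e => pickGain_nonneg _ _ _ _ _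
  have hsum := le_add_sum_marginal hsub T V
  change _ ≤ g V + ∑ e ∈ T \ V, m e at hsum
  rw [← Finset.sum_filter_add_sum_filter_not (T \ V) (fun e => G e < m e)] at hsum
  have hA : ∑ e ∈ (T \ V).filter (fun e => ¬ G e < m e), m e ≤ ∑ e, G e :=
    (Finset.sum_le_sum fun e he => not_lt.mp (Finset.mem_filter.mp he).2).trans
      (Finset.sum_le_sum_of_subset_of_nonneg (Finset.subset_univ _) fun e _ _ => hG e)
  set U := (T \ V).filter fun e => G e < m e with hU
  have hUmem : ∀ e ∈ U, e ∈ T ∧ e ∉ V ∧ G e < m e := fun e he => by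
    simpa [hU, and_assoc] using he
  have hB : ∑ e ∈ U, m e ≤ g V + M := by
    rcases U.eq_empty_or_nonempty with h0 | hne
    · rw [h0, Finset.sum_empty]
      exact add_nonneg (hg V) hM0
    obtain ⟨a, haU, ha⟩ := U.exists_max_image c hne
    obtain ⟨u, huU, hu⟩ := U.exists_max_image (density g c V) hne
    have hkey : density g c V u * (b - c a) ≤ g V - g ∅ :=
      density_mul_le_densityGreedyAux hsub hc S (ha u huU) (Fintype.card E) ∅ b (by simp)
        (hUmem u huU).2.1 (hUmem u huU).2.2
    have hdu : 0 ≤ density g c V u :=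
      div_nonneg ((hG u).trans (hUmem u huU).2.2.le) (hc u).le
    have hcost : c a + ∑ e ∈ U.erase a, c e ≤ b := by
      rw [Finset.add_sum_erase _ _ haU]
      exact (Finset.sum_le_sum_of_subset_of_nonneg (fun e he => (hUmem e he).1)
        fun e _ _ => (hc e).le).trans hT
    have hrest : ∑ e ∈ U.erase a, m e ≤ density g c V u * ∑ e ∈ U.erase a, c e := by
      rw [Finset.mul_sum]
      refine Finset.sum_le_sum fun e he => ?_
      rw [← div_mul_cancel₀ (m e) (hc e).ne']
      exact mul_le_mul_of_nonneg_right (hu e (Finset.mem_of_mem_erase he)) (hc e).le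
    have hma : m a ≤ g {a} - g ∅ :=
      marginal_antitone hsub (Finset.empty_subset V) (hUmem a haU).2.1
    have := mul_le_mul_of_nonneg_left (by linarith : ∑ e ∈ U.erase a, c e ≤ b - c a) hdu
    rw [← Finset.add_sum_erase _ _ haU]
    linarith [hM a, hg ∅]
  linarith

end Greedy

/-- Sampling whether `e` belongs to the random set is independent of any function of the other
items. -/
lemma sum_ite_mem_mul_insert [Fintype E] [DecidableEq E] (σ : ℝ) (e : E) (h : Finset E → ℝ) :
    ∑ S : Finset E, σ ^ S.card * (1 - σ) ^ (Fintype.card E - S.card) *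
        (if e ∈ S then h (insert e S) else 0) =
      σ * ∑ S : Finset E, σ ^ S.card * (1 - σ) ^ (Fintype.card E - S.card) * h (insert e S) := by
  have he : e ∉ (Finset.univ.erase e : Finset E) := Finset.notMem_erase _ _
  rw [← Finset.powerset_univ, ← Finset.insert_erase (Finset.mem_univ e),
    Finset.sum_powerset_insert he, Finset.sum_powerset_insert he, ← Finset.sum_add_distrib,
    ← Finset.sum_add_distrib, Finset.mul_sum]
  refine Finset.sum_congr rfl fun S hS => ?_
  have heS : e ∉ S := fun h => he (Finset.mem_powerset.mp hS h)
  have hlt : S.card < Fintype.card E := Finset.card_lt_univ_of_notMem heS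
  obtain ⟨k, hk⟩ := Nat.exists_eq_add_of_lt hlt
  rw [if_neg heS, if_pos (Finset.mem_insert_self _ _), Finset.card_insert_of_notMem heS,
    Finset.insert_idem, hk, show S.card + k + 1 - S.card = k + 1 by omega,
    show S.card + k + 1 - (S.card + 1) = k by omega]
  ring

theorem sampled_density_greedy_bound
    [Fintype E] [DecidableEq E] [Nonempty E] [LinearOrder E]
    (g : Finset E → ℝ) (c : E → ℝ) (b : ℝ)
    (hg : ∀ S : Finset E, 0 ≤ g S)
    (hsub : ∀ S T : Finset E, g (S ∪ T) + g (S ∩ T) ≤ g S + g T)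
    (hc : ∀ e : E, 0 < c e) (hb : 0 < b)
    (σ : ℝ) (hσ0 : 0 < σ) (hσ1 : σ ≤ 1)
    (Tstar : Finset E) (hTstar : ∑ e ∈ Tstar, c e ≤ b)
    (hTopt : ∀ T : Finset E, ∑ e ∈ T, c e ≤ b → g T ≤ g Tstar) :
    (2 + 1 / σ) *
        (∑ S : Finset E,
          σ ^ S.card * (1 - σ) ^ (Fintype.card E - S.card) * g (densityGreedy g c b S)) +
      (Finset.univ.sup' Finset.univ_nonempty fun e : E => g {e}) ≥
      ∑ S : Finset E,
        σ ^ S.card * (1 - σ) ^ (Fintype.card E - S.card) *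
          g (Tstar ∪ densityGreedy g c b S) := by
  set w : Finset E → ℝ := fun S => σ ^ S.card * (1 - σ) ^ (Fintype.card E - S.card) with hw
  set M := Finset.univ.sup' Finset.univ_nonempty fun e : E => g {e}
  set G : Finset E → E → ℝ := fun S e => pickGain g c S e (Fintype.card E) ∅ b with hG
  have hw0 : ∀ S, 0 ≤ w S := fun S =>
    mul_nonneg (pow_nonneg hσ0.le _) (pow_nonneg (sub_nonneg.mpr hσ1) _)
  have hw1 : ∑ S, w S = 1 := by
    rw [hw, Fintype.sum_pow_mul_eq_add_pow]
    simp
  have hgain : σ * ∑ S, w S * ∑ e, G (insert e S) e =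
      ∑ S, w S * (g (densityGreedy g c b S) - g ∅) := by
    have hS : ∀ S, g (densityGreedy g c b S) - g ∅ =
        ∑ e, if e ∈ S then G (insert e S) e else 0 := fun S => by
      rw [densityGreedy, ← sum_pickGain, ← Finset.sum_filter, Finset.filter_mem_eq_inter,
        Finset.univ_inter]
      exact Finset.sum_congr rfl fun e he => by rw [hG, Finset.insert_eq_of_mem he]
    have hswap : ∀ f : Finset E → E → ℝ, ∑ S, w S * ∑ e, f S e = ∑ e, ∑ S, w S * f S e :=
      fun f => by simp only [Finset.mul_sum]; exact Finset.sum_comm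
    simp only [hS]
    rw [hswap, hswap, Finset.mul_sum]
    exact Finset.sum_congr rfl fun e _ => (sum_ite_mem_mul_insert σ e fun S => G S e).symm
  have hle : σ * ∑ S, w S * ∑ e, G (insert e S) e ≤ ∑ S, w S * g (densityGreedy g c b S) := by
    rw [hgain]
    exact Finset.sum_le_sum fun S _ =>
      mul_le_mul_of_nonneg_left (sub_le_self _ (hg ∅)) (hw0 S)
  rw [mul_comm, ← le_div_iff₀ hσ0] at hle
  calc ∑ S, w S * g (Tstar ∪ densityGreedy g c b S)
      ≤ ∑ S, w S * (2 * g (densityGreedy g c b S) + ∑ e, G (insert e S) e + M) :=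
        Finset.sum_le_sum fun S _ =>
          mul_le_mul_of_nonneg_left (union_densityGreedy_le hg hsub hc hTstar S) (hw0 S)
    _ = 2 * ∑ S, w S * g (densityGreedy g c b S) + ∑ S, w S * ∑ e, G (insert e S) e + M := by
        simp only [mul_add, Finset.sum_add_distrib, ← Finset.sum_mul, hw1, one_mul,
          mul_left_comm _ (2 : ℝ), ← Finset.mul_sum]
    _ ≤ (2 + 1 / σ) * ∑ S, w S * g (densityGreedy g c b S) + M := by
        rw [add_mul, one_div_mul_eq_div]
        linarith
end
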